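/- Let α = √(a_{ij}(x)yⁱyʲ) and β = b_i(x)yⁱ be a Riemannian metric and a 1-form on an open subset U ⊆ ℝ², and let k₁, k₂, k₃ be constants with 1 + (k₁+k₃)t + k₂t² > 0 for all t ∈ [0, sup_U b²]. Suppose b_{i|j} = 2τ{(1+k₁b²)a_{ij} + (k₂b²+k₃)b_ib_j} for a scalar function τ(x). Define c(B) := exp(∫₀^B ½(k₃+k₂t)/(1+(k₁+k₃)t+k₂t²) dt) and the 1-form β̃ with components b̃_i := b_i/c(b²). Then the covariant derivative of β̃ with respect to α satisfies b̃_{i|j} = [2τ(1+k₁b²)/c(b²)]·a_{ij}; in particular β̃ is a closed 1-form that is conformal with respect to α. -/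

import Mathlib

open scoped BigOperators
open Real

noncomputable section

/-- Points (and vectors) of the plane. -/
abbrev Pt : Type := Fin 2 → ℝ

/-- Partial derivative of a scalar function on `ℝ²` in the `j`-th coordinate direction. -/
def pd (f : Pt → ℝ) (j : Fin 2) (x : Pt) : ℝ := fderiv ℝ f x (Pi.single j 1)

/-- Christoffel symbols `γ^k_{ij}` of a Riemannian metric `a`. -/
def christoffel (a : Pt → Matrix (Fin 2) (Fin 2) ℝ) (k i j : Fin 2) (x : Pt) : ℝ :=
  (1/2) * ∑ l, (a x)⁻¹ k l *
    (pd (fun z => a z l j) i x + pd (fun z => a z l i) j x - pd (fun z => a z i j) l x)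

/-- Covariant derivative `c_{i|j}` of a 1-form `c` with respect to the metric `a`. -/
def covD (a : Pt → Matrix (Fin 2) (Fin 2) ℝ) (c : Pt → Fin 2 → ℝ) (i j : Fin 2) (x : Pt) : ℝ :=
  pd (fun z => c z i) j x - ∑ k, c x k * christoffel a k i j x

/-- `r_{ij}`, the symmetrized covariant derivative of the 1-form `b`. -/
def rr (a : Pt → Matrix (Fin 2) (Fin 2) ℝ) (b : Pt → Fin 2 → ℝ) (i j : Fin 2) (x : Pt) : ℝ :=
  (covD a b i j x + covD a b j i x) / 2

/-- `s_{ij}`, the antisymmetrized covariant derivative of the 1-form `b`. -/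
def so (a : Pt → Matrix (Fin 2) (Fin 2) ℝ) (b : Pt → Fin 2 → ℝ) (i j : Fin 2) (x : Pt) : ℝ :=
  (covD a b i j x - covD a b j i x) / 2

/-- `bⁱ := a^{ik} b_k`. -/
def bUp (a : Pt → Matrix (Fin 2) (Fin 2) ℝ) (b : Pt → Fin 2 → ℝ) (i : Fin 2) (x : Pt) : ℝ :=
  ∑ k, (a x)⁻¹ i k * b x k

/-- `b² := a^{ij} b_i b_j`, the squared norm of `β` with respect to `α`. -/
def bsq (a : Pt → Matrix (Fin 2) (Fin 2) ℝ) (b : Pt → Fin 2 → ℝ) (x : Pt) : ℝ :=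
  ∑ i, bUp a b i x * b x i

/-- `s_j := bⁱ s_{ij}`. -/
def sLow (a : Pt → Matrix (Fin 2) (Fin 2) ℝ) (b : Pt → Fin 2 → ℝ) (j : Fin 2) (x : Pt) : ℝ :=
  ∑ i, bUp a b i x * so a b i j x

/-- `sⁱ := a^{ik} s_k`. -/
def sUp (a : Pt → Matrix (Fin 2) (Fin 2) ℝ) (b : Pt → Fin 2 → ℝ) (i : Fin 2) (x : Pt) : ℝ :=
  ∑ k, (a x)⁻¹ i k * sLow a b k x

/-- `s₀ := s_j y^j`. -/
def sZero (a : Pt → Matrix (Fin 2) (Fin 2) ℝ) (b : Pt → Fin 2 → ℝ) (x : Pt) (y : Fin 2 → ℝ) : ℝ :=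
  ∑ j, sLow a b j x * y j

/-- The Riemannian norm `α(x,y) = √(a_{ij} yⁱ yʲ)`. -/
def alphaF (a : Pt → Matrix (Fin 2) (Fin 2) ℝ) (x : Pt) (y : Fin 2 → ℝ) : ℝ :=
  Real.sqrt (∑ i, ∑ j, a x i j * y i * y j)

/-- The 1-form `β(x,y) = b_i(x) yⁱ`. -/
def betaF (b : Pt → Fin 2 → ℝ) (x : Pt) (y : Fin 2 → ℝ) : ℝ := ∑ i, b x i * y i

/-- Fundamental tensor `g_{ij} := ½ [F²]_{yⁱyʲ}` of a Finsler metric `F`. -/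
def gMat (F : Pt → (Fin 2 → ℝ) → ℝ) (x : Pt) (y : Fin 2 → ℝ) : Matrix (Fin 2) (Fin 2) ℝ :=
  Matrix.of fun i j =>
    (1/2) * fderiv ℝ (fun y1 => fderiv ℝ (fun y2 => (F x y2)^2) y1 (Pi.single j 1)) y
      (Pi.single i 1)

/-- Spray coefficients `Gⁱ := ¼ g^{il} ([F²]_{x^k y^l} y^k − [F²]_{x^l})` of a Finsler metric. -/
def spray (F : Pt → (Fin 2 → ℝ) → ℝ) (i : Fin 2) (x : Pt) (y : Fin 2 → ℝ) : ℝ :=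
  (1/4) * ∑ l, (gMat F x y)⁻¹ i l *
    ((∑ k, (fderiv ℝ (fun x' => fderiv ℝ (fun y' => (F x' y')^2) y (Pi.single l 1)) x
        (Pi.single k 1)) * y k)
      - fderiv ℝ (fun x' => (F x' y)^2) x (Pi.single l 1))

/-- `F` is a Douglas metric on `U`: for each `x ∈ U`, `G¹y² − G²y¹` is a homogeneous
polynomial of degree 3 in `(y¹, y²)`. -/
def IsDouglasOn (F : Pt → (Fin 2 → ℝ) → ℝ) (U : Set Pt) : Prop :=
  ∀ x ∈ U, ∃ c0 c1 c2 c3 : ℝ, ∀ y : Fin 2 → ℝ, y ≠ 0 →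
    spray F 0 x y * y 1 - spray F 1 x y * y 0 =
      c0 * (y 0)^3 + c1 * (y 0)^2 * y 1 + c2 * (y 0) * (y 1)^2 + c3 * (y 1)^3

/-- The Hamel operator `F_{x^m y^l} y^m − F_{x^l}`. -/
def Hamel (F : Pt → (Fin 2 → ℝ) → ℝ) (x : Pt) (y : Fin 2 → ℝ) (l : Fin 2) : ℝ :=
  (∑ m, fderiv ℝ (fun x' => fderiv ℝ (fun y' => F x' y') y (Pi.single l 1)) x
      (Pi.single m 1) * y m)
    - fderiv ℝ (fun x' => F x' y) x (Pi.single l 1)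

/-- `F` is projectively flat on `U` (Hamel equations). -/
def ProjFlatOn (F : Pt → (Fin 2 → ℝ) → ℝ) (U : Set Pt) : Prop :=
  ∀ x ∈ U, ∀ y : Fin 2 → ℝ, y ≠ 0 → ∀ l, Hamel F x y l = 0

/-- Spray coefficients `G^i_α := ½ γ^i_{jk} y^j y^k` of the Riemannian metric `α`. -/
def sprayA (a : Pt → Matrix (Fin 2) (Fin 2) ℝ) (i : Fin 2) (x : Pt) (y : Fin 2 → ℝ) : ℝ :=
  (1/2) * ∑ j, ∑ k, christoffel a i j k x * y j * y k

/-- The projective factor `P = F_{x^m} y^m / (2F)`. -/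
def projFac (F : Pt → (Fin 2 → ℝ) → ℝ) (x : Pt) (y : Fin 2 → ℝ) : ℝ :=
  (∑ m, fderiv ℝ (fun x' => F x' y) x (Pi.single m 1) * y m) / (2 * F x y)

/-- Pullback of a Finsler metric under a coordinate map `ψ`. -/
def pullF (F : Pt → (Fin 2 → ℝ) → ℝ) (ψ : Pt → Pt) : Pt → (Fin 2 → ℝ) → ℝ :=
  fun z y => F (ψ z) (fderiv ℝ ψ z y)

/-- `ψ` is a (curvilinear) coordinate chart: a smooth injective map from the open set `V`
into `U` with everywhere invertible differential. -/
def IsCoordChart (ψ : Pt → Pt) (V U : Set Pt) : Prop :=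
  IsOpen V ∧ ContDiffOn ℝ (⊤ : ℕ∞) ψ V ∧ Set.InjOn ψ V ∧ ψ '' V ⊆ U ∧
    ∀ z ∈ V, LinearMap.det ((fderiv ℝ ψ z) : Pt →ₗ[ℝ] Pt) ≠ 0

/-- `F` is locally projectively flat on `U`: around every point there are local coordinates
in which `F` satisfies the Hamel equations. -/
def IsLocProjFlatOn (F : Pt → (Fin 2 → ℝ) → ℝ) (U : Set Pt) : Prop :=
  ∀ x ∈ U, ∃ (V : Set Pt) (ψ : Pt → Pt), IsCoordChart ψ V U ∧ x ∈ ψ '' V ∧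
    ProjFlatOn (pullF F ψ) V


open scoped Matrix

section PartialDerivatives

variable {f g : Pt → ℝ} {x : Pt} (j : Fin 2)

lemma pd_mul (hf : DifferentiableAt ℝ f x) (hg : DifferentiableAt ℝ g x) :
    pd (fun z => f z * g z) j x = f x * pd g j x + g x * pd f j x := by
  simp [pd, fderiv_fun_mul hf hg]

lemma pd_add (hf : DifferentiableAt ℝ f x) (hg : DifferentiableAt ℝ g x) :
    pd (fun z => f z + g z) j x = pd f j x + pd g j x := by
  simp [pd, fderiv_fun_add hf hg]

lemma pd_sub (hf : DifferentiableAt ℝ f x) (hg : DifferentiableAt ℝ g x) :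
    pd (fun z => f z - g z) j x = pd f j x - pd g j x := by
  simp [pd, fderiv_fun_sub hf hg]

lemma pd_comp {φ : ℝ → ℝ} {φ' : ℝ} (hφ : HasDerivAt φ φ' (f x)) (hf : DifferentiableAt ℝ f x) :
    pd (fun z => φ (f z)) j x = φ' * pd f j x := by
  have h := hφ.comp_hasFDerivAt x hf.hasFDerivAt
  simpa [pd, Function.comp_def] using congrArg (fun L => L (Pi.single j 1)) h.fderiv

lemma pd_congr (h : f =ᶠ[nhds x] g) : pd f j x = pd g j x := by
  rw [pd, pd, h.fderiv_eq]

end PartialDerivatives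

lemma bsq_eq_div_det (a : Pt → Matrix (Fin 2) (Fin 2) ℝ) (b : Pt → Fin 2 → ℝ) (x : Pt) :
    bsq a b x = (a x 1 1 * (b x 0 * b x 0) - (a x 0 1 + a x 1 0) * (b x 0 * b x 1)
      + a x 0 0 * (b x 1 * b x 1)) / (a x 0 0 * a x 1 1 - a x 0 1 * a x 1 0) := by
  simp only [bsq, bUp, Fin.sum_univ_two, Matrix.inv_def, Matrix.adjugate_fin_two,
    Matrix.det_fin_two, Ring.inverse_eq_inv', Matrix.smul_apply, smul_eq_mul, Matrix.of_apply,
    Matrix.cons_val', Matrix.cons_val_zero, Matrix.cons_val_one, Matrix.cons_val_fin_one]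
  ring

/-- Lowering the index: `bⁱ a_{ij} = b_j`. -/
lemma sum_bUp_mul {a : Pt → Matrix (Fin 2) (Fin 2) ℝ} (b : Pt → Fin 2 → ℝ) {x : Pt}
    (hsym : (a x).IsSymm) (hunit : IsUnit (a x)) (j : Fin 2) :
    ∑ i, bUp a b i x * a x i j = b x j := by
  have h : (a x) *ᵥ ((a x)⁻¹ *ᵥ b x) = b x := by
    rw [Matrix.mulVec_mulVec, Matrix.mul_nonsing_inv _ ((a x).isUnit_iff_isUnit_det.mp hunit),
      Matrix.one_mulVec]
  rw [← congrFun h j]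
  simp only [Matrix.mulVec, dotProduct, bUp, hsym.apply, mul_comm]

lemma bsq_mul_det {a : Pt → Matrix (Fin 2) (Fin 2) ℝ} (b : Pt → Fin 2 → ℝ) {x : Pt}
    (hdet : a x 0 0 * a x 1 1 - a x 0 1 * a x 1 0 ≠ 0) :
    bsq a b x * (a x 0 0 * a x 1 1 - a x 0 1 * a x 1 0) =
      a x 1 1 * (b x 0 * b x 0) - (a x 0 1 + a x 1 0) * (b x 0 * b x 1)
        + a x 0 0 * (b x 1 * b x 1) := by
  rw [bsq_eq_div_det, div_mul_cancel₀ _ hdet]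

lemma bsq_nonneg {a : Pt → Matrix (Fin 2) (Fin 2) ℝ} (b : Pt → Fin 2 → ℝ) {x : Pt}
    (hpos : (a x).PosDef) : 0 ≤ bsq a b x := by
  have h := hpos.inv.posSemidef.dotProduct_mulVec_nonneg (b x)
  simpa [bsq, bUp, dotProduct, Matrix.mulVec, mul_comm] using h

lemma differentiableAt_bsq {a : Pt → Matrix (Fin 2) (Fin 2) ℝ} {b : Pt → Fin 2 → ℝ} {x : Pt}
    (ha : ∀ i j, DifferentiableAt ℝ (fun z => a z i j) x)
    (hb : ∀ i, DifferentiableAt ℝ (fun z => b z i) x)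
    (hdet : a x 0 0 * a x 1 1 - a x 0 1 * a x 1 0 ≠ 0) :
    DifferentiableAt ℝ (bsq a b) x := by
  rw [funext (bsq_eq_div_det a b)]
  have h00 := ha 0 0
  have h01 := ha 0 1
  have h10 := ha 1 0
  have h11 := ha 1 1
  have h0 := hb 0
  have h1 := hb 1
  fun_prop (disch := assumption)

/-- Metric compatibility: `∂_j b² = 2 bⁱ b_{i|j}`. -/
lemma pd_bsq {a : Pt → Matrix (Fin 2) (Fin 2) ℝ} {b : Pt → Fin 2 → ℝ} {x : Pt}
    (ha : ∀ i j, DifferentiableAt ℝ (fun z => a z i j) x)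
    (hb : ∀ i, DifferentiableAt ℝ (fun z => b z i) x)
    (hsym : ∀ᶠ z in nhds x, (a z).IsSymm)
    (hdet : a x 0 0 * a x 1 1 - a x 0 1 * a x 1 0 ≠ 0) (j : Fin 2) :
    pd (bsq a b) j x = 2 * ∑ i, bUp a b i x * covD a b i j x := by
  have h00 := ha 0 0
  have h01 := ha 0 1
  have h10 := ha 1 0
  have h11 := ha 1 1
  have h0 := hb 0
  have h1 := hb 1
  have hB := differentiableAt_bsq ha hb hdet
  have hdet_near : ∀ᶠ z in nhds x, a z 0 0 * a z 1 1 - a z 0 1 * a z 1 0 ≠ 0 :=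
    have hd : DifferentiableAt ℝ (fun z => a z 0 0 * a z 1 1 - a z 0 1 * a z 1 0) x := by fun_prop
    hd.continuousAt.eventually_ne hdet
  have hloc : (fun z => bsq a b z * (a z 0 0 * a z 1 1 - a z 0 1 * a z 1 0)) =ᶠ[nhds x]
      fun z => a z 1 1 * (b z 0 * b z 0) - (a z 0 1 + a z 1 0) * (b z 0 * b z 1)
        + a z 0 0 * (b z 1 * b z 1) :=
    hdet_near.mono fun z hz => bsq_mul_det b hz
  have hpd := pd_congr j hloc
  rw [pd_mul j hB (by fun_prop), pd_sub j (by fun_prop) (by fun_prop), pd_mul j h00 h11,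
    pd_mul j h01 h10, pd_add j (by fun_prop) (by fun_prop), pd_sub j (by fun_prop) (by fun_prop),
    pd_mul j h11 (by fun_prop), pd_mul j h0 h0, pd_mul j (by fun_prop) (by fun_prop),
    pd_add j h01 h10, pd_mul j h0 h1, pd_mul j h00 (by fun_prop), pd_mul j h1 h1] at hpd
  have hs : a x 1 0 = a x 0 1 := hsym.self_of_nhds.apply 0 1
  have hpds (l : Fin 2) : pd (fun z => a z 1 0) l x = pd (fun z => a z 0 1) l x :=
    pd_congr l (hsym.mono fun z hz => hz.apply 0 1)
  rw [mul_comm _ (pd (bsq a b) j x), bsq_eq_div_det] at hpd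
  simp only [hs, hpds] at hpd hdet
  have hpd' := eq_div_of_mul_eq hdet (eq_sub_of_add_eq' hpd)
  rw [hpd']
  simp only [covD, bUp, christoffel, Fin.sum_univ_two, Matrix.inv_def, Matrix.adjugate_fin_two,
    Matrix.det_fin_two, Ring.inverse_eq_inv', Matrix.smul_apply, smul_eq_mul, Matrix.of_apply,
    Matrix.cons_val', Matrix.cons_val_zero, Matrix.cons_val_one, Matrix.cons_val_fin_one, hs]
  generalize hD : a x 0 0 * a x 1 1 - a x 0 1 * a x 0 1 = D at hdet ⊢
  fin_cases j <;>
  · simp only [Fin.zero_eta, Fin.mk_one, hpds]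
    field_simp
    rw [← hD]
    ring

/-- Leibniz rule for the product of a scalar function with a 1-form. -/
lemma covD_mul (a : Pt → Matrix (Fin 2) (Fin 2) ℝ) {b : Pt → Fin 2 → ℝ} {f : Pt → ℝ} {x : Pt}
    (i j : Fin 2) (hf : DifferentiableAt ℝ f x) (hb : DifferentiableAt ℝ (fun z => b z i) x) :
    covD a (fun z k => f z * b z k) i j x = f x * covD a b i j x + pd f j x * b x i := by
  simp only [covD, pd_mul j hf hb, Fin.sum_univ_two]
  ring

/-- The exponent of `c(B)` has derivative its integrand where the denominator is positive. -/
lemma hasDerivAt_integral_ratio {k₁ k₂ k₃ B : ℝ} (hB : 0 ≤ B)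
    (hden : ∀ t ∈ Set.Icc (0 : ℝ) B, 0 < 1 + (k₁ + k₃) * t + k₂ * t ^ 2) :
    HasDerivAt (fun u => ∫ t in (0 : ℝ)..u,
        (1 / 2) * ((k₃ + k₂ * t) / (1 + (k₁ + k₃) * t + k₂ * t ^ 2)))
      ((1 / 2) * ((k₃ + k₂ * B) / (1 + (k₁ + k₃) * B + k₂ * B ^ 2))) B := by
  have hcont : ∀ t ∈ Set.Icc (0 : ℝ) B, ContinuousAt
      (fun t : ℝ => (1 / 2) * ((k₃ + k₂ * t) / (1 + (k₁ + k₃) * t + k₂ * t ^ 2))) t := by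
    intro t ht
    have := (hden t ht).ne'
    fun_prop (disch := assumption)
  refine intervalIntegral.integral_hasDerivAt_right ?_ ?_ (hcont B ⟨hB, le_rfl⟩)
  · refine ContinuousOn.intervalIntegrable fun t ht => (hcont t ?_).continuousWithinAt
    rwa [Set.uIcc_of_le hB] at ht
  · have hm : Measurable
        (fun t : ℝ => (1 / 2) * ((k₃ + k₂ * t) / (1 + (k₁ + k₃) * t + k₂ * t ^ 2))) := by
      fun_prop
    exact hm.stronglyMeasurable.stronglyMeasurableAtFilter

/-- the 1-form deformation in the proof of Theorem 1.3: `β̃ = β/c(b²)`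
is a closed conformal 1-form with respect to `α`. -/
theorem stmt19 (k₁ k₂ k₃ : ℝ)
    (U : Set Pt) (hU : IsOpen U)
    (a : Pt → Matrix (Fin 2) (Fin 2) ℝ) (b : Pt → Fin 2 → ℝ)
    (ha : ∀ i j, ContDiffOn ℝ (⊤ : ℕ∞) (fun x => a x i j) U)
    (hsym : ∀ x ∈ U, ∀ i j, a x i j = a x j i)
    (hpos : ∀ x ∈ U, (a x).PosDef)
    (hb : ∀ i, ContDiffOn ℝ (⊤ : ℕ∞) (fun x => b x i) U)
    (hden : ∀ x ∈ U, ∀ t ∈ Set.Icc (0:ℝ) (bsq a b x), 0 < 1 + (k₁ + k₃)*t + k₂*t^2)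
    (τ : Pt → ℝ)
    (hcov : ∀ x ∈ U, ∀ i j, covD a b i j x =
      2 * τ x * ((1 + k₁ * bsq a b x) * a x i j + (k₂ * bsq a b x + k₃) * b x i * b x j))
    (bt : Pt → Fin 2 → ℝ)
    (hbt : ∀ x, ∀ i, bt x i = b x i / Real.exp (∫ t in (0:ℝ)..(bsq a b x),
      (1/2) * ((k₃ + k₂*t) / (1 + (k₁ + k₃)*t + k₂*t^2)))) :
    (∀ x ∈ U, ∀ i j, covD a bt i j x =
      (2 * τ x * (1 + k₁ * bsq a b x) / Real.exp (∫ t in (0:ℝ)..(bsq a b x),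
          (1/2) * ((k₃ + k₂*t) / (1 + (k₁ + k₃)*t + k₂*t^2)))) * a x i j) ∧
    -- in particular β̃ is closed …
    (∀ x ∈ U, ∀ i j, covD a bt i j x = covD a bt j i x) ∧
    -- … and conformal with respect to α
    (∃ lam : Pt → ℝ, ∀ x ∈ U, ∀ i j,
      (covD a bt i j x + covD a bt j i x) / 2 = lam x * a x i j) := by
  have key : ∀ x ∈ U, ∀ i j, covD a bt i j x =
      (2 * τ x * (1 + k₁ * bsq a b x) / Real.exp (∫ t in (0:ℝ)..(bsq a b x),
          (1/2) * ((k₃ + k₂*t) / (1 + (k₁ + k₃)*t + k₂*t^2)))) * a x i j := by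
    intro x hx i j
    have hUx : U ∈ nhds x := hU.mem_nhds hx
    have hax (i j) : DifferentiableAt ℝ (fun z => a z i j) x :=
      ((ha i j).contDiffAt hUx).differentiableAt (by simp)
    have hbx (i) : DifferentiableAt ℝ (fun z => b z i) x :=
      ((hb i).contDiffAt hUx).differentiableAt (by simp)
    have hdet : a x 0 0 * a x 1 1 - a x 0 1 * a x 1 0 ≠ 0 := by
      simpa [Matrix.det_fin_two] using (hpos x hx).det_pos.ne'
    have hsymx : ∀ᶠ z in nhds x, (a z).IsSymm :=
      Filter.mem_of_superset hUx fun z hz => Matrix.IsSymm.ext fun i j => hsym z hz j i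
    have hB0 := bsq_nonneg b (hpos x hx)
    have hD := hden x hx _ ⟨hB0, le_rfl⟩
    have hBd := differentiableAt_bsq hax hbx hdet
    have hpdB : pd (bsq a b) j x =
        4 * τ x * (1 + (k₁ + k₃) * bsq a b x + k₂ * bsq a b x ^ 2) * b x j := by
      have hlower : ∑ i, bUp a b i x * a x i j = b x j :=
        sum_bUp_mul b hsymx.self_of_nhds (hpos x hx).isUnit j
      have hnorm : ∑ i, bUp a b i x * b x i = bsq a b x := rfl
      rw [pd_bsq hax hbx hsymx hdet]
      simp only [hcov x hx, Fin.sum_univ_two] at hlower hnorm ⊢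
      linear_combination 4 * τ x * (1 + k₁ * bsq a b x) * hlower
        + 4 * τ x * (k₂ * bsq a b x + k₃) * b x j * hnorm
    have hφ := (hasDerivAt_integral_ratio hB0 (hden x hx)).fun_neg.exp
    have hbt' : bt = fun z k => Real.exp (-∫ t in (0:ℝ)..(bsq a b z),
        (1/2) * ((k₃ + k₂*t) / (1 + (k₁ + k₃)*t + k₂*t^2))) * b z k := by
      funext z k
      rw [hbt, Real.exp_neg, div_eq_inv_mul]
    rw [hbt', covD_mul a i j (hφ.differentiableAt.fun_comp' x hBd) (hbx i), pd_comp j hφ hBd,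
      hpdB, hcov x hx, Real.exp_neg]
    generalize Real.exp _ = c
    generalize 1 + (k₁ + k₃) * bsq a b x + k₂ * bsq a b x ^ 2 = D at hD ⊢
    field_simp
    ring
  refine ⟨key, fun x hx i j => ?_, fun x => 2 * τ x * (1 + k₁ * bsq a b x) /
    Real.exp (∫ t in (0:ℝ)..(bsq a b x), (1/2) * ((k₃ + k₂*t) / (1 + (k₁ + k₃)*t + k₂*t^2))), fun x hx i j => ?_⟩
  · rw [key x hx, key x hx, hsym x hx i j]
  · rw [key x hx, key x hx, hsym x hx j i, add_self_div_two]

end
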